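/- Under Assumptions (A) and (B), suppose p_{ij} = p for all i ≠ j with 0 < p < 1/(d−1) (completely symmetric routing). Then a vector γ = (γ_1,…,γ_d) ∈ ℝ_+^d belongs to Γ if and only if γ_i > 0 for all i ∈ {1,…,d} and Σ(γ_1,…,γ_d) < 1. -/

import Mathlib

open scoped BigOperators
open Filter

/-- The `i`-th standard unit vector in `ℤ^d`. -/
def unitZ {d : ℕ} (i : Fin d) : Fin d → ℤ := fun k => if k = i then 1 else 0

/-- The jump rates `q(y)` of the Jackson network: `q(ε^i) = λ_i`,
`q(-ε^i) = μ_i p_{i0}`, `q(ε^j - ε^i) = μ_i p_{ij}` and `q(y) = 0` otherwise. -/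
noncomputable def qrate {d : ℕ} (lam mu : Fin d → ℝ) (P : Fin d → Fin d → ℝ)
    (y : Fin d → ℤ) : ℝ :=
  (∑ i, lam i * (if y = unitZ i then 1 else 0))
    + (∑ i, mu i * (1 - ∑ j, P i j) * (if y = -unitZ i then 1 else 0))
    + (∑ i, ∑ j, mu i * P i j * (if y = unitZ j - unitZ i then 1 else 0))

/-- Assumption (A): irreducibility of the matrix `(q(x - y); x, y ∈ ℤ^d)`. -/
def AssumptionA {d : ℕ} (lam mu : Fin d → ℝ) (P : Fin d → Fin d → ℝ) : Prop :=
  ∀ x y : Fin d → ℤ, ∃ (n : ℕ) (c : Fin (n + 1) → Fin d → ℤ),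
    c 0 = x ∧ c (Fin.last n) = y ∧
      ∀ k : Fin n, 0 < qrate lam mu P (c k.succ - c k.castSucc)

/-- The generator `ℒ` of the Jackson network:
`(ℒ f)(x) = ∑_{z ∈ ℤ_+^d} q(z - x) (f z - f x)`. -/
noncomputable def gen {d : ℕ} (lam mu : Fin d → ℝ) (P : Fin d → Fin d → ℝ)
    (f : (Fin d → ℕ) → ℝ) (x : Fin d → ℕ) : ℝ :=
  ∑' z : Fin d → ℕ, qrate lam mu P (fun k => (z k : ℤ) - (x k : ℤ)) * (f z - f x)

/-- The hitting-probability matrix `Q j i = G j i / G i i`. -/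
noncomputable def hitQ {d : ℕ} (G : Fin d → Fin d → ℝ) : Fin d → Fin d → ℝ :=
  fun j i => G j i / G i i

/-- The vector `γ⃗_i`, with components `γ_i^j = log (1 + Q j i * γ i)`. -/
noncomputable def gvec {d : ℕ} (Q : Fin d → Fin d → ℝ) (γ : Fin d → ℝ) (i j : Fin d) : ℝ :=
  Real.log (1 + Q j i * γ i)

/-- The set `Γ`: all `γ ∈ ℝ_+^d` such that for every `i` and every nonzero
`v ∈ ℝ_+^d` with `v i = 0` one has `γ⃗_i ⬝ v < max_j γ⃗_j ⬝ v`. -/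
def GammaSet (d : ℕ) (Q : Fin d → Fin d → ℝ) : Set (Fin d → ℝ) :=
  {γ | (∀ i, 0 ≤ γ i) ∧
    ∀ i : Fin d, ∀ v : Fin d → ℝ, (∀ j, 0 ≤ v j) → v ≠ 0 → v i = 0 →
      (∑ j, gvec Q γ i j * v j) < ⨆ l : Fin d, ∑ j, gvec Q γ l j * v j}

/-- The function Σ(γ_1,…,γ_d) for the completely symmetric routing matrix, where
qq = p / (1 - (d-2)p) is the common off-diagonal hitting probability. -/
noncomputable def SigmaFun {d : ℕ} (qq : ℝ) (γ : Fin d → ℝ) : ℝ :=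
  ∑ j, ((⨆ i : Fin d, Real.log (1 + qq * γ i)) - Real.log (1 + qq * γ j))
        / (Real.log (1 + γ j) - Real.log (1 + qq * γ j))

/-- The pairing `γ⃗_i ⬝ v` when all off-diagonal hitting probabilities equal `q`. -/
lemma sum_gvec_mul_of_symmetric {d : ℕ} {Q : Fin d → Fin d → ℝ} {q : ℝ}
    (hdiag : ∀ i, Q i i = 1) (hoff : ∀ i j, i ≠ j → Q i j = q) (γ v : Fin d → ℝ) (i : Fin d) :
    ∑ j, gvec Q γ i j * v j = Real.log (1 + q * γ i) * ∑ j, v j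
      + (Real.log (1 + γ i) - Real.log (1 + q * γ i)) * v i := by
  have hterm : ∀ j, gvec Q γ i j * v j = Real.log (1 + q * γ i) * v j
      + if j = i then (Real.log (1 + γ i) - Real.log (1 + q * γ i)) * v i else 0 := by
    intro j
    by_cases h : j = i
    · subst h
      simp only [gvec, hdiag, one_mul, if_true]
      ring
    · simp [gvec, hoff j i h, h]
  simp only [hterm, Finset.sum_add_distrib, ← Finset.mul_sum, Finset.sum_ite_eq',
    Finset.mem_univ, if_true]

/-- If the weights `((⨆ a) - a j) / c j` sum to less than one, then `a i` times the mass of `v`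
is never the maximum of `a l * (∑ v) + c l * v l`. -/
lemma mul_sum_lt_iSup_of_sum_div_lt_one {ι : Type*} [Fintype ι] {a c : ι → ℝ}
    (hc : ∀ i, 0 < c i) (hsum : ∑ j, ((⨆ i, a i) - a j) / c j < 1) (i : ι) {v : ι → ℝ}
    (hv : ∀ j, 0 ≤ v j) (hv0 : v ≠ 0) :
    a i * ∑ j, v j < ⨆ l, (a l * ∑ j, v j + c l * v l) := by
  have hS : 0 < ∑ j, v j := by
    obtain ⟨j, hj⟩ := Function.ne_iff.mp hv0
    exact Finset.sum_pos' (fun j _ => hv j) ⟨j, Finset.mem_univ j, (hv j).lt_of_ne' hj⟩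
  by_contra! h
  have hle : ∀ l, v l ≤ ((⨆ i, a i) - a l) / c l * ∑ j, v j := by
    intro l
    have h₁ := (le_ciSup (Set.finite_range fun l => a l * ∑ j, v j + c l * v l).bddAbove l).trans h
    have h₂ := mul_le_mul_of_nonneg_right (le_ciSup (Set.finite_range a).bddAbove i) hS.le
    rw [div_mul_eq_mul_div, le_div_iff₀ (hc l)]
    linarith
  have h₃ := Finset.sum_le_sum fun l (_ : l ∈ Finset.univ) => hle l
  rw [← Finset.sum_mul] at h₃
  nlinarith

/-- If the weights `((⨆ a) - a j) / c j` sum to at least one, then they are a vector `v` for which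
the maximum of `a l * (∑ v) + c l * v l` is `a i` times the mass of `v`, for some `i` with
`v i = 0`. -/
lemma exists_iSup_le_mul_sum_of_one_le_sum_div {ι : Type*} [Fintype ι] [Nonempty ι] {a c : ι → ℝ}
    (hc : ∀ i, 0 < c i) (hsum : 1 ≤ ∑ j, ((⨆ i, a i) - a j) / c j) :
    ∃ (i : ι) (v : ι → ℝ), (∀ j, 0 ≤ v j) ∧ v ≠ 0 ∧ v i = 0 ∧
      ⨆ l, (a l * ∑ j, v j + c l * v l) ≤ a i * ∑ j, v j := by
  obtain ⟨i, hi⟩ := exists_eq_ciSup_of_finite (f := a)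
  have ha : ∀ j, a j ≤ ⨆ i, a i := le_ciSup (Set.finite_range a).bddAbove
  refine ⟨i, fun j => ((⨆ i, a i) - a j) / c j,
    fun j => div_nonneg (sub_nonneg.2 (ha j)) (hc j).le, ?_, by simp [hi], ciSup_le fun l => ?_⟩
  · intro h
    simp only [funext_iff, Pi.zero_apply] at h
    simp only [h, Finset.sum_const_zero] at hsum
    linarith
  · rw [mul_div_cancel₀ _ (hc l).ne', hi]
    nlinarith [mul_le_mul_of_nonneg_left hsum (sub_nonneg.2 (ha l))]

/-- Proposition 3.3: for the completely symmetric routing matrix, a vector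
γ ∈ ℝ_+^d belongs to Γ iff γ_i > 0 for all i and Σ(γ_1,…,γ_d) < 1. -/
theorem stmt11
    (d : ℕ) (hd : 0 < d)
    (lam mu : Fin d → ℝ) (P : Fin d → Fin d → ℝ)
    (hlam : ∀ i, 0 ≤ lam i) (hmu : ∀ i, 0 < mu i)
    (hP : ∀ i j, 0 ≤ P i j) (hPdiag : ∀ i, P i i = 0) (hP0 : ∀ i, ∑ j, P i j ≤ 1)
    (hA : AssumptionA lam mu P)
    (G : Fin d → Fin d → ℝ)
    (hG1 : ∀ i k, ∑ j, G i j * ((if j = k then (1 : ℝ) else 0) - P j k)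
      = if i = k then 1 else 0)
    (hG2 : ∀ i k, ∑ j, ((if i = j then (1 : ℝ) else 0) - P i j) * G j k
      = if i = k then 1 else 0)
    (hGnn : ∀ i j, 0 ≤ G i j) (hGdiag : ∀ i, 1 ≤ G i i)
    (ν : Fin d → ℝ) (hν : ∀ j, ν j = lam j + ∑ i, ν i * P i j) (hνpos : ∀ i, 0 < ν i)
    (hB : ∀ i, ν i < mu i)
    (p : ℝ) (hp : 0 < p) (hpd : p < 1 / ((d : ℝ) - 1))
    (hsym : ∀ i j : Fin d, i ≠ j → P i j = p)
    (hQ : ∀ i j : Fin d, i ≠ j → hitQ G i j = p / (1 - ((d : ℝ) - 2) * p))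
    (γ : Fin d → ℝ) (hγ : ∀ i, 0 ≤ γ i) :
    γ ∈ GammaSet d (hitQ G) ↔
      (∀ i, 0 < γ i) ∧ SigmaFun (p / (1 - ((d : ℝ) - 2) * p)) γ < 1 := by
  have hd2 : (2 : ℝ) ≤ d := by
    have : d ≠ 1 := by
      rintro rfl
      norm_num at hpd
      linarith
    exact_mod_cast (show 2 ≤ d by omega)
  have : Nonempty (Fin d) := ⟨⟨0, hd⟩⟩
  have : Nontrivial (Fin d) := Fin.nontrivial_iff_two_le.2 (by exact_mod_cast hd2)
  rw [lt_div_iff₀ (by linarith)] at hpd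
  have hden : p < 1 - ((d : ℝ) - 2) * p := by linarith
  have hq0 : 0 < p / (1 - ((d : ℝ) - 2) * p) := div_pos hp (hp.trans hden)
  have hq1 : p / (1 - ((d : ℝ) - 2) * p) < 1 := (div_lt_one (hp.trans hden)).2 hden
  set q := p / (1 - ((d : ℝ) - 2) * p)
  have hdiag : ∀ i, hitQ G i i = 1 := fun i =>
    div_self (zero_lt_one.trans_le (hGdiag i)).ne'
  have hc : ∀ i, 0 < γ i → 0 < Real.log (1 + γ i) - Real.log (1 + q * γ i) := fun i hi =>
    sub_pos.2 (Real.log_lt_log (by positivity) (by nlinarith))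
  simp only [GammaSet, Set.mem_ofPred_eq, sum_gvec_mul_of_symmetric hdiag hQ]
  constructor
  · rintro ⟨-, h⟩
    have hpos : ∀ i, 0 < γ i := by
      refine fun k => (hγ k).lt_of_ne' fun hk => ?_
      obtain ⟨j, hj⟩ := exists_ne k
      obtain ⟨i, hik, hi⟩ := Finset.exists_max_image (Finset.univ.erase k) γ ⟨j, by simp [hj]⟩
      have hik : i ≠ k := Finset.ne_of_mem_erase hik
      have hle : ∀ l, γ l ≤ γ i := by
        intro l
        by_cases hl : l = k
        · rw [hl, hk]
          exact hγ i
        · exact hi l (by simp [hl])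
      refine (h i (Pi.single k 1) (fun l => ?_) (by simp) (by simp [hik])).not_ge
        (ciSup_le fun l => ?_)
      · exact (Pi.single_nonneg.2 zero_le_one : (0 : Fin d → ℝ) ≤ Pi.single k 1) l
      · have hlog : Real.log (1 + q * γ l) ≤ Real.log (1 + q * γ i) :=
          Real.log_le_log (by have := hγ l; positivity) (by gcongr; exact hle l)
        by_cases hl : l = k
        · subst hl
          simpa [hik, hk] using hlog
        · simpa [hik, hl] using hlog
    refine ⟨hpos, ?_⟩
    by_contra! hsum
    obtain ⟨i, v, hv, hv0, hvi, hle⟩ :=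
      exists_iSup_le_mul_sum_of_one_le_sum_div (fun i => hc i (hpos i)) hsum
    have := h i v hv hv0 hvi
    rw [hvi, mul_zero, add_zero] at this
    exact this.not_ge hle
  · rintro ⟨hpos, hsum⟩
    refine ⟨hγ, fun i v hv hv0 hvi => ?_⟩
    rw [hvi, mul_zero, add_zero]
    exact mul_sum_lt_iSup_of_sum_div_lt_one (fun i => hc i (hpos i)) hsum i hv hv0
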